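/- Let n ≥ 1 and let Γ₁(2n) ⊆ SL(2,ℤ) be the congruence subgroup of matrices congruent to (1 *; 0 1) modulo 2n. Let SL(2,ℤ) (and hence Γ₁(2n)) act on (ℤ/2ℤ)² through reduction of matrix entries modulo 2 followed by matrix–vector multiplication. Then the restriction map in group cohomology H^1(SL(2,ℤ), (ℤ/2ℤ)²) → H^1(Γ₁(2n), (ℤ/2ℤ)²) is injective. -/

import Mathlib

open groupCohomology

/-- The 1-coboundaries as a submodule of the 1-cocycles (Mathlib's former
`groupCohomology.oneCoboundaries`). -/
def oneCoboundaries {k G : Type} [CommRing k] [Group G] (A : Rep.{0} k G) :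
    Submodule k (cocycles₁ A) :=
  LinearMap.range ((d₀₁ A).hom.codRestrict (cocycles₁ A) fun c =>
    coboundaries₁_le_cocycles₁ A (LinearMap.mem_range_self (d₀₁ A).hom c))

/-- 1-cocycles modulo 1-coboundaries (Mathlib's former definition of `groupCohomology.H1`). -/
abbrev oneCocyclesModOneCoboundaries {k G : Type} [CommRing k] [Group G] (A : Rep.{0} k G) :=
  cocycles₁ A ⧸ oneCoboundaries A

/-- The representation of `SL(2,ℤ)` on `(ℤ/2ℤ)²` given by reducing matrix entries modulo `2`
and then acting by matrix–vector multiplication. -/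
noncomputable def sl2zModTwoRep :
    Representation (ZMod 2) (Matrix.SpecialLinearGroup (Fin 2) ℤ) (Fin 2 → ZMod 2) :=
  (LinearEquiv.automorphismGroup.toLinearMapMonoidHom).comp
    ((Matrix.SpecialLinearGroup.toLin').comp
      (Matrix.SpecialLinearGroup.map (Int.castRingHom (ZMod 2))))

/-- The restriction of the above representation to the congruence subgroup `Γ₁(2n)`. -/
noncomputable def gamma1ModTwoRep (n : ℕ) :
    Representation (ZMod 2) (CongruenceSubgroup.Gamma1 (2 * n)) (Fin 2 → ZMod 2) :=
  sl2zModTwoRep.comp (CongruenceSubgroup.Gamma1 (2 * n)).subtype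

open ModularGroup

/-- A 1-cocycle that is the coboundary of `m` on a generating set is the coboundary of `m`. -/
theorem cocycle_eq_coboundary_of_closure_eq_top {k G V : Type*} [CommRing k] [Group G]
    [AddCommGroup V] [Module k V] (ρ : Representation k G V) {f : G → V}
    (hf : ∀ g h, f (g * h) = ρ g (f h) + f g) {s : Set G} (hs : Subgroup.closure s = ⊤) {m : V}
    (hm : ∀ g ∈ s, f g = ρ g m - m) (g : G) : f g = ρ g m - m := by
  have hf_one : f 1 = 0 := by simpa using hf 1 1
  have hg : g ∈ Subgroup.closure s := hs ▸ Subgroup.mem_top g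
  induction hg using Subgroup.closure_induction with
  | mem x hx => exact hm x hx
  | one => simp [hf_one]
  | mul x y _ _ hx hy => simp [hf, hx, hy]
  | inv x _ hx =>
    have h := hf x⁻¹ x
    rw [inv_mul_cancel, hf_one, hx, map_sub, Representation.inv_self_apply] at h
    rw [← sub_eq_zero, h]
    abel

theorem sl2zModTwoRep_apply (g : Matrix.SpecialLinearGroup (Fin 2) ℤ) (v : Fin 2 → ZMod 2) :
    sl2zModTwoRep g v = (g.1.map (Int.castRingHom (ZMod 2))).mulVec v := rfl

theorem sl2zModTwoRep_S (v : Fin 2 → ZMod 2) : sl2zModTwoRep S v = ![v 1, v 0] := by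
  ext i
  fin_cases i <;>
    simp [sl2zModTwoRep_apply, coe_S, Matrix.mulVec, dotProduct, Fin.sum_univ_two,
      ZMod.neg_eq_self_mod_two]

theorem sl2zModTwoRep_T (v : Fin 2 → ZMod 2) : sl2zModTwoRep T v = ![v 0 + v 1, v 1] := by
  ext i
  fin_cases i <;>
    simp [sl2zModTwoRep_apply, coe_T, Matrix.mulVec, dotProduct, Fin.sum_univ_two]

/-- The central element `-1 = S * S` acts trivially, so a cocycle sends it to an invariant vector,
and `0` is the only one. -/
theorem sl2z_cocycle_S_mul_S {f : Matrix.SpecialLinearGroup (Fin 2) ℤ → (Fin 2 → ZMod 2)}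
    (hf : ∀ g h, f (g * h) = sl2zModTwoRep g (f h) + f g) : f (S * S) = 0 := by
  have hSS : sl2zModTwoRep (S * S) = 1 := by
    ext1 v
    ext i
    fin_cases i <;> simp [sl2zModTwoRep_S]
  have invariant (g) (hg : S * S * g = g * (S * S)) : sl2zModTwoRep g (f (S * S)) = f (S * S) := by
    have h := hf (S * S) g
    rw [hg, hf g, hSS, Module.End.one_apply, add_comm] at h
    exact add_left_cancel h
  have hS := invariant S (mul_assoc S S S)
  have hT := invariant T (by
    ext i j
    fin_cases i <;> fin_cases j <;> simp [coe_S, coe_T])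
  rw [sl2zModTwoRep_S] at hS
  rw [sl2zModTwoRep_T] at hT
  have hS0 : f (S * S) 1 = f (S * S) 0 := by simpa using congrFun hS 0
  have hT0 : f (S * S) 1 = 0 := by simpa using congrFun hT 0
  ext i
  fin_cases i
  · exact hS0.symm.trans hT0
  · exact hT0

/-- A cocycle of `SL(2,ℤ)` in `(ℤ/2ℤ)²` that is a coboundary at `T` is a coboundary. -/
theorem sl2z_cocycle_eq_coboundary {f : Matrix.SpecialLinearGroup (Fin 2) ℤ → (Fin 2 → ZMod 2)}
    (hf : ∀ g h, f (g * h) = sl2zModTwoRep g (f h) + f g) {m : Fin 2 → ZMod 2}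
    (hm : f T = sl2zModTwoRep T m - m) :
    ∃ x, ∀ g, f g = sl2zModTwoRep g x - x := by
  have hS : f S 1 = f S 0 := by
    have h := hf S S
    rw [sl2z_cocycle_S_mul_S hf, sl2zModTwoRep_S] at h
    have h0 : 0 = f S 1 + f S 0 := congrFun h 0
    exact CharTwo.add_eq_zero.1 h0.symm
  have hT : f T 1 = 0 := by
    rw [hm, sl2zModTwoRep_T]
    simp
  refine ⟨![f S 0 + f T 0, f T 0], cocycle_eq_coboundary_of_closure_eq_top _ hf
    SpecialLinearGroup.SL2Z_generators ?_⟩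
  rintro g (rfl | rfl)
  · rw [sl2zModTwoRep_S]
    ext i
    fin_cases i
    · simp [CharTwo.sub_eq_add, add_left_comm, CharTwo.add_self_eq_zero]
    · simpa using hS
  · rw [sl2zModTwoRep_T]
    ext i
    fin_cases i
    · simp
    · simpa using hT

theorem mem_oneCoboundaries_iff {k G : Type} [CommRing k] [Group G] {A : Rep.{0} k G}
    (f : cocycles₁ A) : f ∈ oneCoboundaries A ↔ ∃ x : A, ∀ g, f g = A.ρ g x - x := by
  simp only [oneCoboundaries, LinearMap.mem_range]
  refine exists_congr fun x => ⟨fun h g => ?_, fun h => cocycles₁_ext fun g => (h g).symm⟩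
  rw [← h]
  rfl

/-- Restriction of 1-cocycles from `SL(2,ℤ)` to `Γ₁(2n)`. -/
noncomputable def restrictCocycles (n : ℕ) :
    cocycles₁ (Rep.of sl2zModTwoRep) →ₗ[ZMod 2] cocycles₁ (Rep.of (gamma1ModTwoRep n)) where
  toFun f := ⟨fun γ => f (γ : Matrix.SpecialLinearGroup (Fin 2) ℤ),
    (mem_cocycles₁_iff _).2 fun g h => (mem_cocycles₁_iff _).1 f.2 g h⟩
  map_add' _ _ := rfl
  map_smul' _ _ := rfl

theorem restrictCocycles_mem_oneCoboundaries_iff (n : ℕ)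
    (f : cocycles₁ (Rep.of sl2zModTwoRep)) :
    restrictCocycles n f ∈ oneCoboundaries (Rep.of (gamma1ModTwoRep n)) ↔
      f ∈ oneCoboundaries (Rep.of sl2zModTwoRep) := by
  rw [mem_oneCoboundaries_iff, mem_oneCoboundaries_iff]
  constructor
  · rintro ⟨m, hm⟩
    have hT : T ∈ CongruenceSubgroup.Gamma1 (2 * n) := by
      rw [CongruenceSubgroup.Gamma1_mem]
      simp [coe_T]
    exact sl2z_cocycle_eq_coboundary ((mem_cocycles₁_iff _).1 f.2) (hm ⟨T, hT⟩)
  · rintro ⟨x, hx⟩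
    exact ⟨x, fun γ => hx γ⟩

/-- for `n ≥ 1`, restriction of `1`-cocycles from `SL(2,ℤ)` to `Γ₁(2n)` induces
a map `H^1(SL(2,ℤ), (ℤ/2ℤ)²) → H^1(Γ₁(2n), (ℤ/2ℤ)²)` on group cohomology, and this map is
injective. -/
theorem restriction_H1_SL2Z_to_Gamma1_injective (n : ℕ) (hn : 1 ≤ n) :
    (∀ f : cocycles₁ (Rep.of sl2zModTwoRep),
        (fun γ : CongruenceSubgroup.Gamma1 (2 * n) =>
            f (γ : Matrix.SpecialLinearGroup (Fin 2) ℤ)) ∈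
          cocycles₁ (Rep.of (gamma1ModTwoRep n))) ∧
    ∃ res : oneCocyclesModOneCoboundaries (Rep.of sl2zModTwoRep) →ₗ[ZMod 2]
          oneCocyclesModOneCoboundaries (Rep.of (gamma1ModTwoRep n)),
      (∀ (f : cocycles₁ (Rep.of sl2zModTwoRep))
          (h : (fun γ : CongruenceSubgroup.Gamma1 (2 * n) =>
              f (γ : Matrix.SpecialLinearGroup (Fin 2) ℤ)) ∈
            cocycles₁ (Rep.of (gamma1ModTwoRep n))),
          res (Submodule.Quotient.mk f) =
            Submodule.Quotient.mk
              (⟨fun γ : CongruenceSubgroup.Gamma1 (2 * n) =>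
                  f (γ : Matrix.SpecialLinearGroup (Fin 2) ℤ), h⟩ :
                cocycles₁ (Rep.of (gamma1ModTwoRep n)))) ∧
      Function.Injective res := by
  refine ⟨fun f => (restrictCocycles n f).2, Submodule.mapQ _ _ (restrictCocycles n)
    fun f hf => (restrictCocycles_mem_oneCoboundaries_iff n f).2 hf, fun f h => rfl, ?_⟩
  rw [injective_iff_map_eq_zero]
  intro x hx
  induction x using Submodule.Quotient.induction_on with
  | H f =>
    rw [Submodule.mapQ_apply, Submodule.Quotient.mk_eq_zero] at hx
    rw [Submodule.Quotient.mk_eq_zero]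
    exact (restrictCocycles_mem_oneCoboundaries_iff n f).1 hx
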